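/- Let (C•,d_C), (D•,d_D) be cochain complexes in 𝒞, f : C• → D• and g : D• → C• cochain maps of degree 0, and H : g∘f → 1_{C•}, K : f∘g → 1_{D•} homotopies. Fix graded lifts C̄•, D̄• along F, a differential d̄_D on D̄• lifting d_D, a differential d̄_C on C̄• lifting d_C, and a cochain map f̄ : (C̄•,d̄_C) → (D̄•,d̄_D) with F(f̄) = f. Assume that H∘g − g∘K = δ(z) for some graded map z : D• → C• of degree −2 (i.e. the class [Hg − gK] vanishes in H^{−1} of the Hom-complex Hom•(D•,C•)). Then there exist a cochain map ḡ : (D̄•,d̄_D) → (C̄•,d̄_C) with F(ḡ) = g and homotopies H̄ : ḡ∘f̄ → 1_{C̄•} and K̄ : f̄∘ḡ → 1_{D̄•} with F(H̄) = H and F(K̄) = K. -/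

import Mathlib

open CategoryTheory

namespace Paper

/-- A graded object: a `ℤ`-indexed family of objects. -/
abbrev GradedObj (A : Type*) [Category A] := ℤ → A

/-- A graded map of degree `n` from `X` to `Y`. -/
abbrev GMap {A : Type*} [Category A] (X Y : GradedObj A) (n : ℤ) :=
  ∀ i : ℤ, X i ⟶ Y (i + n)

/-- Composition of graded maps, in diagrammatic order (`gcomp h f g` is "`g ∘ f`"),
with prescribed total degree `k = n + m`. -/
def gcomp {A : Type*} [Category A] {X Y Z : GradedObj A} {n m k : ℤ} (h : n + m = k)
    (f : GMap X Y n) (g : GMap Y Z m) : GMap X Z k :=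
  fun i => f i ≫ g (i + n) ≫ eqToHom (congrArg Z (show i + n + m = i + k by omega))

/-- The identity graded map of degree `0`. -/
def gid {A : Type*} [Category A] (X : GradedObj A) : GMap X X 0 :=
  fun i => eqToHom (congrArg X (add_zero i).symm)

/-- `δ(f) = d_Y ∘ f - (-1)ⁿ ⬝ f ∘ d_X` for pre-differentials `d_X`, `d_Y` and a graded
map `f` of degree `n`; the result has degree `m = n + 1`. -/
def gdelta {A : Type*} [Category A] [Preadditive A] {X Y : GradedObj A}
    (dX : GMap X X 1) (dY : GMap Y Y 1) {n m : ℤ} (h : n + 1 = m) (f : GMap X Y n) :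
    GMap X Y m :=
  gcomp h f dY - (n.negOnePow : ℤ) • gcomp (show 1 + n = m by omega) dX f

/-- The image of a graded object under a functor. -/
abbrev Fgr {A B : Type*} [Category A] [Category B] (F : B ⥤ A) (X : GradedObj B) :
    GradedObj A := fun i => F.obj (X i)

/-- The image of a graded map under a functor. -/
def Fmap {A B : Type*} [Category A] [Category B] (F : B ⥤ A) {X Y : GradedObj B} {n : ℤ}
    (f : GMap X Y n) : GMap (Fgr F X) (Fgr F Y) n := fun i => F.map (f i)

/-- `Ker(F)² = 0`: the composite of two `F`-killed morphisms vanishes. -/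
def KerSq {A B : Type*} [Category A] [Category B] [Preadditive A] [Preadditive B]
    (F : B ⥤ A) : Prop :=
  ∀ ⦃X Y Z : B⦄ (u : X ⟶ Y) (v : Y ⟶ Z), F.map u = 0 → F.map v = 0 → u ≫ v = 0

/-- `f : (X,dX) → (Y,dY)` and `g : (Y,dY) → (X,dX)` are cochain maps which are homotopy
inverse to each other. -/
def IsHomotopyEquivPair {A : Type*} [Category A] [Preadditive A] {X Y : GradedObj A}
    (dX : GMap X X 1) (dY : GMap Y Y 1) (f : GMap X Y 0) (g : GMap Y X 0) : Prop :=
  gdelta dX dY (show (0:ℤ) + 1 = 1 by omega) f = 0 ∧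
  gdelta dY dX (show (0:ℤ) + 1 = 1 by omega) g = 0 ∧
  (∃ H : GMap X X (-1), gdelta dX dX (show (-1:ℤ) + 1 = 0 by omega) H
      = gid X - gcomp (show (0:ℤ) + 0 = 0 by omega) f g) ∧
  (∃ K : GMap Y Y (-1), gdelta dY dY (show (-1:ℤ) + 1 = 0 by omega) K
      = gid Y - gcomp (show (0:ℤ) + 0 = 0 by omega) g f)


section GradedMaps

variable {A : Type*} [Category A]

lemma gmap_eq_eqToHom_comp {X Y : GradedObj A} {n : ℤ} (f : GMap X Y n) {i j : ℤ} (h : i = j) :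
    f i = eqToHom (congrArg X h) ≫ f j ≫ eqToHom (congrArg Y (by rw [h])) := by
  subst h
  simp

lemma gcomp_assoc {W X Y Z : GradedObj A} {n m p nm mp k : ℤ} (h₃ : m + p = mp)
    (h₁ : n + m = nm) (h₂ : nm + p = k) (a : GMap W X n) (b : GMap X Y m) (c : GMap Y Z p) :
    gcomp h₂ (gcomp h₁ a b) c = gcomp (show n + mp = k by omega) a (gcomp h₃ b c) := by
  subst h₁ h₃ h₂
  funext i
  simp only [gcomp, Category.assoc]
  rw [gmap_eq_eqToHom_comp c (show i + n + m = i + (n + m) by omega)]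
  simp

lemma gid_gcomp {X Y : GradedObj A} {n : ℤ} (h : 0 + n = n) (f : GMap X Y n) :
    gcomp h (gid X) f = f := by
  funext i
  simp only [gcomp, gid]
  rw [gmap_eq_eqToHom_comp f (show i + 0 = i by omega)]
  simp

lemma gcomp_gid {X Y : GradedObj A} {n : ℤ} (h : n + 0 = n) (f : GMap X Y n) :
    gcomp h f (gid Y) = f := by
  funext i
  simp [gcomp, gid]

section Functor

variable {B : Type*} [Category B] (F : B ⥤ A)

lemma Fmap_gcomp {X Y Z : GradedObj B} {n m k : ℤ} (h : n + m = k) (f : GMap X Y n)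
    (g : GMap Y Z m) : Fmap F (gcomp h f g) = gcomp h (Fmap F f) (Fmap F g) := by
  funext i
  simp [Fmap, gcomp, eqToHom_map]

lemma Fmap_gid (X : GradedObj B) : Fmap F (gid X) = gid (Fgr F X) := by
  funext i
  simp [Fmap, gid, eqToHom_map]

lemma exists_Fmap_eq [F.Full] {X Y : GradedObj B} {n : ℤ} (f : GMap (Fgr F X) (Fgr F Y) n) :
    ∃ f' : GMap X Y n, Fmap F f' = f :=
  ⟨fun i => F.preimage (f i), funext fun i => F.map_preimage (f i)⟩

end Functor

variable [Preadditive A]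

section Linearity

variable {X Y Z : GradedObj A} {n m k : ℤ} (h : n + m = k)

lemma gcomp_add (f : GMap X Y n) (g g' : GMap Y Z m) :
    gcomp h f (g + g') = gcomp h f g + gcomp h f g' := by
  funext i
  simp [gcomp]

lemma add_gcomp (f f' : GMap X Y n) (g : GMap Y Z m) :
    gcomp h (f + f') g = gcomp h f g + gcomp h f' g := by
  funext i
  simp [gcomp]

lemma gcomp_sub (f : GMap X Y n) (g g' : GMap Y Z m) :
    gcomp h f (g - g') = gcomp h f g - gcomp h f g' := by
  funext i
  simp [gcomp]

lemma sub_gcomp (f f' : GMap X Y n) (g : GMap Y Z m) :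
    gcomp h (f - f') g = gcomp h f g - gcomp h f' g := by
  funext i
  simp [gcomp]

lemma gcomp_neg (f : GMap X Y n) (g : GMap Y Z m) :
    gcomp h f (-g) = -gcomp h f g := by
  funext i
  simp [gcomp]

lemma neg_gcomp (f : GMap X Y n) (g : GMap Y Z m) :
    gcomp h (-f) g = -gcomp h f g := by
  funext i
  simp [gcomp]

lemma gcomp_zero (f : GMap X Y n) : gcomp h f (0 : GMap Y Z m) = 0 := by
  funext i
  simp [gcomp]

lemma zero_gcomp (g : GMap Y Z m) : gcomp h (0 : GMap X Y n) g = 0 := by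
  funext i
  simp [gcomp]

lemma gcomp_zsmul (r : ℤ) (f : GMap X Y n) (g : GMap Y Z m) :
    gcomp h f (r • g) = r • gcomp h f g := by
  funext i
  simp [gcomp]

lemma zsmul_gcomp (r : ℤ) (f : GMap X Y n) (g : GMap Y Z m) :
    gcomp h (r • f) g = r • gcomp h f g := by
  funext i
  simp [gcomp]

end Linearity

section Differential

variable {X Y Z : GradedObj A} (dX : GMap X X 1) (dY : GMap Y Y 1) (dZ : GMap Z Z 1)

lemma gdelta_add {n m : ℤ} (h : n + 1 = m) (f g : GMap X Y n) :
    gdelta dX dY h (f + g) = gdelta dX dY h f + gdelta dX dY h g := by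
  simp only [gdelta, add_gcomp, gcomp_add, smul_add]
  abel

lemma gdelta_sub {n m : ℤ} (h : n + 1 = m) (f g : GMap X Y n) :
    gdelta dX dY h (f - g) = gdelta dX dY h f - gdelta dX dY h g := by
  simp only [gdelta, sub_gcomp, gcomp_sub, smul_sub]
  abel

lemma gdelta_gid (h : (0 : ℤ) + 1 = 1) : gdelta dX dX h (gid X) = 0 := by
  simp [gdelta, gid_gcomp, gcomp_gid]

/-- The graded Leibniz rule. -/
lemma gdelta_gcomp {n m k n' m' k' : ℤ} (hn : n + 1 = n') (hm : m + 1 = m')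
    (h : n + m = k) (hk : k + 1 = k') (f : GMap X Y n) (g : GMap Y Z m) :
    gdelta dX dZ hk (gcomp h f g) =
      gcomp (show n + m' = k' by omega) f (gdelta dY dZ hm g) +
        (m.negOnePow : ℤ) • gcomp (show n' + m = k' by omega) (gdelta dX dY hn f) g := by
  have hs : (k.negOnePow : ℤ) = (m.negOnePow : ℤ) * (n.negOnePow : ℤ) := by
    rw [← h, Int.negOnePow_add, Units.val_mul, mul_comm]
  simp only [gdelta, gcomp_sub, sub_gcomp, gcomp_zsmul, zsmul_gcomp, smul_sub, smul_smul, hs,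
    gcomp_assoc hm, gcomp_assoc (show 1 + m = m' by omega), gcomp_assoc h]
  abel

lemma gdelta_gdelta (h₂ : (1 : ℤ) + 1 = 2) (hX : gcomp h₂ dX dX = 0) (hY : gcomp h₂ dY dY = 0)
    {n m k : ℤ} (h : n + 1 = m) (h' : m + 1 = k) (f : GMap X Y n) :
    gdelta dX dY h' (gdelta dX dY h f) = 0 := by
  have hs : (m.negOnePow : ℤ) = -(n.negOnePow : ℤ) := by
    rw [← h, Int.negOnePow_succ, Units.val_neg]
  have hX' : gcomp (show 1 + m = k by omega) dX (gcomp (show 1 + n = m by omega) dX f) = 0 := by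
    rw [← gcomp_assoc (show 1 + n = m by omega) h₂ (show 2 + n = k by omega), hX, zero_gcomp]
  simp only [gdelta, gcomp_sub, sub_gcomp, gcomp_zsmul, zsmul_gcomp, hs, smul_sub,
    gcomp_assoc h₂, gcomp_assoc h, hY, hX', gcomp_zero, smul_zero]
  simp

end Differential

section AdditiveFunctor

variable {B : Type*} [Category B] [Preadditive B] (F : B ⥤ A) [F.Additive]

lemma Fmap_add {X Y : GradedObj B} {n : ℤ} (f g : GMap X Y n) :
    Fmap F (f + g) = Fmap F f + Fmap F g := by
  funext i
  simp [Fmap]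

lemma Fmap_sub {X Y : GradedObj B} {n : ℤ} (f g : GMap X Y n) :
    Fmap F (f - g) = Fmap F f - Fmap F g := by
  funext i
  simp [Fmap]

lemma Fmap_zsmul {X Y : GradedObj B} {n : ℤ} (r : ℤ) (f : GMap X Y n) :
    Fmap F (r • f) = r • Fmap F f := by
  funext i
  simp [Fmap]

lemma Fmap_gdelta {X Y : GradedObj B} (dX : GMap X X 1) (dY : GMap Y Y 1) {n m : ℤ}
    (h : n + 1 = m) (f : GMap X Y n) :
    Fmap F (gdelta dX dY h f) = gdelta (Fmap F dX) (Fmap F dY) h (Fmap F f) := by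
  simp only [gdelta, Fmap_sub, Fmap_zsmul, Fmap_gcomp]

end AdditiveFunctor

lemma KerSq.gcomp_eq_zero {B : Type*} [Category B] [Preadditive B] {F : B ⥤ A} (hF : KerSq F)
    {X Y Z : GradedObj B} {n m k : ℤ} (h : n + m = k) {u : GMap X Y n} {v : GMap Y Z m}
    (hu : Fmap F u = 0) (hv : Fmap F v = 0) : gcomp h u v = 0 := by
  funext i
  refine hF _ _ (congrFun hu i) ?_
  have hv' : F.map (v (i + n)) = 0 := congrFun hv (i + n)
  rw [F.map_comp, hv', Limits.zero_comp]

/-- If the obstruction `H ∘ g - g ∘ K` is a coboundary, then so is `f ∘ H - K ∘ f`. -/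
lemma exists_gdelta_eq_of_obstruction {X Y : GradedObj A} {dX : GMap X X 1} {dY : GMap Y Y 1}
    (e₀ : (0 : ℤ) + 0 = 0) (e₁ : (0 : ℤ) + 1 = 1) (e₂ : (-1 : ℤ) + 1 = 0)
    (e₃ : (0 : ℤ) + -1 = -1) (e₄ : (-1 : ℤ) + 0 = -1) (e₅ : (-2 : ℤ) + 1 = -1)
    {f : GMap X Y 0} {g : GMap Y X 0} (hf : gdelta dX dY e₁ f = 0)
    {H : GMap X X (-1)} (hH : gdelta dX dX e₂ H = gid X - gcomp e₀ f g)
    {K : GMap Y Y (-1)} (hK : gdelta dY dY e₂ K = gid Y - gcomp e₀ g f)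
    {z : GMap Y X (-2)} (hz : gcomp e₃ g H - gcomp e₄ K g = gdelta dY dX e₅ z) :
    ∃ y : GMap X Y (-2), gdelta dX dY e₅ y = gcomp e₄ H f - gcomp e₃ f K := by
  refine ⟨gcomp (show (0:ℤ) + -2 = -2 by omega) f (gcomp (show (-2:ℤ) + 0 = -2 by omega) z f)
    - gcomp (show (0:ℤ) + -2 = -2 by omega) f (gcomp (show (-1:ℤ) + -1 = -2 by omega) K K)
    - gcomp (show (-1:ℤ) + -1 = -2 by omega) H
      (gcomp e₄ H f - gcomp e₃ f K), ?_⟩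
  simp only [gdelta_sub,
    gdelta_gcomp dX dY dY e₁ e₅,
    gdelta_gcomp dX dY dY e₁ e₂,
    gdelta_gcomp dY dX dY e₅ e₁,
    gdelta_gcomp dY dY dY e₂ e₂,
    gdelta_gcomp dX dX dY e₂ e₂,
    gdelta_gcomp dX dX dY e₂ e₁,
    hf, hH, hK, ← hz, gcomp_sub, sub_gcomp, gcomp_add, gcomp_neg, gcomp_zero, zero_gcomp,
    gid_gcomp, gcomp_gid,
    gcomp_assoc e₀, gcomp_assoc e₄,
    gcomp_assoc e₃, Int.negOnePow_neg, Int.negOnePow_zero,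
    Int.negOnePow_one, Units.val_neg, Units.val_one, one_smul, neg_smul, smul_zero]
  abel

end GradedMaps

/-- Theorem `comp2`(2): if moreover `[Hg − gK] = 0` in `H⁻¹Hom(D,C)`, then
`g`, `H`, `K` lift compatibly: there are a cochain-map lift `ḡ` of `g` and homotopies
`H̄ : ḡ∘f̄ → 1` and `K̄ : f̄∘ḡ → 1` lifting `H` and `K`. -/
theorem statement8 {B C : Type*} [Category B] [Preadditive B] [Category C] [Preadditive C]
    (F : B ⥤ C) [F.Additive] [F.Full] (hF : KerSq F)
    (Xb Yb : GradedObj B)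
    (dC : GMap (Fgr F Xb) (Fgr F Xb) 1) (dD : GMap (Fgr F Yb) (Fgr F Yb) 1)
    (hdC : gcomp (show (1:ℤ) + 1 = 2 by omega) dC dC = 0)
    (hdD : gcomp (show (1:ℤ) + 1 = 2 by omega) dD dD = 0)
    (f : GMap (Fgr F Xb) (Fgr F Yb) 0) (g : GMap (Fgr F Yb) (Fgr F Xb) 0)
    (hf : gdelta dC dD (show (0:ℤ) + 1 = 1 by omega) f = 0)
    (hg : gdelta dD dC (show (0:ℤ) + 1 = 1 by omega) g = 0)
    (H : GMap (Fgr F Xb) (Fgr F Xb) (-1))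
    (hH : gdelta dC dC (show (-1:ℤ) + 1 = 0 by omega) H
      = gid (Fgr F Xb) - gcomp (show (0:ℤ) + 0 = 0 by omega) f g)
    (K : GMap (Fgr F Yb) (Fgr F Yb) (-1))
    (hK : gdelta dD dD (show (-1:ℤ) + 1 = 0 by omega) K
      = gid (Fgr F Yb) - gcomp (show (0:ℤ) + 0 = 0 by omega) g f)
    (dCb : GMap Xb Xb 1) (hdCb : Fmap F dCb = dC)
    (hdCbsq : gcomp (show (1:ℤ) + 1 = 2 by omega) dCb dCb = 0)
    (dDb : GMap Yb Yb 1) (hdDb : Fmap F dDb = dD)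
    (hdDbsq : gcomp (show (1:ℤ) + 1 = 2 by omega) dDb dDb = 0)
    (fb : GMap Xb Yb 0) (hfb : Fmap F fb = f)
    (hfbc : gdelta dCb dDb (show (0:ℤ) + 1 = 1 by omega) fb = 0)
    -- `[Hg − gK] = 0 ∈ H⁻¹ Hom(D,C)`
    (z : GMap (Fgr F Yb) (Fgr F Xb) (-2))
    (hz : gcomp (show (0:ℤ) + -1 = -1 by omega) g H
        - gcomp (show (-1:ℤ) + 0 = -1 by omega) K g
      = gdelta dD dC (show (-2:ℤ) + 1 = -1 by omega) z) :
    ∃ gb : GMap Yb Xb 0, Fmap F gb = g ∧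
      gdelta dDb dCb (show (0:ℤ) + 1 = 1 by omega) gb = 0 ∧
      (∃ Hb : GMap Xb Xb (-1), Fmap F Hb = H ∧
        gdelta dCb dCb (show (-1:ℤ) + 1 = 0 by omega) Hb
          = gid Xb - gcomp (show (0:ℤ) + 0 = 0 by omega) fb gb) ∧
      (∃ Kb : GMap Yb Yb (-1), Fmap F Kb = K ∧
        gdelta dDb dDb (show (-1:ℤ) + 1 = 0 by omega) Kb
          = gid Yb - gcomp (show (0:ℤ) + 0 = 0 by omega) gb fb) := by
  obtain ⟨y, hy⟩ := exists_gdelta_eq_of_obstruction (by omega) (by omega) (by omega)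
    (by omega) (by omega) (by omega) hf hH hK hz
  obtain ⟨g₀, rfl⟩ := exists_Fmap_eq F g
  obtain ⟨H₀, rfl⟩ := exists_Fmap_eq F H
  obtain ⟨K₀, rfl⟩ := exists_Fmap_eq F K
  obtain ⟨y₀, rfl⟩ := exists_Fmap_eq F y
  subst hdCb hdDb hfb
  -- the errors of the lifts, which lie in the kernel of `F`
  obtain ⟨γ, hγ⟩ : ∃ γ, gdelta dDb dCb (show (0:ℤ) + 1 = 1 by omega) g₀ = γ := ⟨_, rfl⟩
  obtain ⟨η, hη⟩ : ∃ η, gdelta dCb dCb (show (-1:ℤ) + 1 = 0 by omega) H₀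
      = gid Xb - gcomp (show (0:ℤ) + 0 = 0 by omega) fb g₀ - η :=
    ⟨_, (sub_sub_cancel _ _).symm⟩
  obtain ⟨κ, hκ⟩ : ∃ κ, gdelta dDb dDb (show (-1:ℤ) + 1 = 0 by omega) K₀
      = gid Yb - gcomp (show (0:ℤ) + 0 = 0 by omega) g₀ fb - κ :=
    ⟨_, (sub_sub_cancel _ _).symm⟩
  obtain ⟨ι, hι⟩ : ∃ ι, gdelta dCb dDb (show (-2:ℤ) + 1 = -1 by omega) y₀
      = gcomp (show (-1:ℤ) + 0 = -1 by omega) H₀ fb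
        - gcomp (show (0:ℤ) + -1 = -1 by omega) fb K₀ - ι :=
    ⟨_, (sub_sub_cancel _ _).symm⟩
  have Fγ : Fmap F γ = 0 := by rw [← hγ, Fmap_gdelta, hg]
  have Fη : Fmap F η = 0 := by
    have := congrArg (Fmap F) hη
    rw [Fmap_gdelta, hH, Fmap_sub, Fmap_sub, Fmap_gid, Fmap_gcomp] at this
    exact sub_eq_self.mp this.symm
  have Fκ : Fmap F κ = 0 := by
    have := congrArg (Fmap F) hκ
    rw [Fmap_gdelta, hK, Fmap_sub, Fmap_sub, Fmap_gid, Fmap_gcomp] at this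
    exact sub_eq_self.mp this.symm
  have Fι : Fmap F ι = 0 := by
    have := congrArg (Fmap F) hι
    rw [Fmap_gdelta, hy, Fmap_sub, Fmap_sub, Fmap_gcomp, Fmap_gcomp] at this
    exact sub_eq_self.mp this.symm
  -- their coboundaries
  have dγ : gdelta dDb dCb (show (1:ℤ) + 1 = 2 by omega) γ = 0 := by
    rw [← hγ, gdelta_gdelta dDb dCb (by omega) hdDbsq hdCbsq]
  have dη : gdelta dCb dCb (show (0:ℤ) + 1 = 1 by omega) η
      = -gcomp (show (0:ℤ) + 1 = 1 by omega) fb γ := by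
    have := gdelta_gdelta dCb dCb (by omega) hdCbsq hdCbsq (show (-1:ℤ) + 1 = 0 by omega)
      (show (0:ℤ) + 1 = 1 by omega) H₀
    rw [hη, gdelta_sub, gdelta_sub, gdelta_gid, sub_eq_zero] at this
    rw [← this, gdelta_gcomp dCb dDb dCb (show (0:ℤ) + 1 = 1 by omega)
      (show (0:ℤ) + 1 = 1 by omega), hγ, hfbc, zero_gcomp, smul_zero, add_zero, zero_sub]
  have dκ : gdelta dDb dDb (show (0:ℤ) + 1 = 1 by omega) κ
      = -gcomp (show (1:ℤ) + 0 = 1 by omega) γ fb := by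
    have := gdelta_gdelta dDb dDb (by omega) hdDbsq hdDbsq (show (-1:ℤ) + 1 = 0 by omega)
      (show (0:ℤ) + 1 = 1 by omega) K₀
    rw [hκ, gdelta_sub, gdelta_sub, gdelta_gid, sub_eq_zero] at this
    rw [← this, gdelta_gcomp dDb dCb dDb (show (0:ℤ) + 1 = 1 by omega)
      (show (0:ℤ) + 1 = 1 by omega), hγ, hfbc, gcomp_zero, Int.negOnePow_zero, Units.val_one,
      one_smul, zero_add, zero_sub]
  have dι : gdelta dCb dDb (show (-1:ℤ) + 1 = 0 by omega) ι
      = gcomp (show (0:ℤ) + 0 = 0 by omega) fb κ - gcomp (show (0:ℤ) + 0 = 0 by omega) η fb := by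
    have := gdelta_gdelta dCb dDb (by omega) hdCbsq hdDbsq (show (-2:ℤ) + 1 = -1 by omega)
      (show (-1:ℤ) + 1 = 0 by omega) y₀
    rw [hι, gdelta_sub, sub_eq_zero] at this
    rw [← this]
    simp only [gdelta_sub,
      gdelta_gcomp dCb dCb dDb (show (-1:ℤ) + 1 = 0 by omega) (show (0:ℤ) + 1 = 1 by omega),
      gdelta_gcomp dCb dDb dDb (show (0:ℤ) + 1 = 1 by omega) (show (-1:ℤ) + 1 = 0 by omega),
      hη, hκ, hfbc, gcomp_sub, sub_gcomp, gcomp_zero, zero_gcomp, smul_zero, gid_gcomp, gcomp_gid,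
      gcomp_assoc (show (0:ℤ) + 0 = 0 by omega), Int.negOnePow_zero, Units.val_one, one_smul]
    abel
  have hηη := hF.gcomp_eq_zero (show (0:ℤ) + 0 = 0 by omega) Fη Fη
  have hκκ := hF.gcomp_eq_zero (show (0:ℤ) + 0 = 0 by omega) Fκ Fκ
  have hγη := hF.gcomp_eq_zero (show (1:ℤ) + 0 = 1 by omega) Fγ Fη
  have hκγ := hF.gcomp_eq_zero (show (0:ℤ) + 1 = 1 by omega) Fκ Fγ
  have hιγ := hF.gcomp_eq_zero (show (-1:ℤ) + 1 = 0 by omega) Fι Fγ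
  have hγι := hF.gcomp_eq_zero (show (1:ℤ) + -1 = 0 by omega) Fγ Fι
  refine ⟨g₀ + gcomp (show (0:ℤ) + 0 = 0 by omega) g₀ η
      + gcomp (show (-1:ℤ) + 1 = 0 by omega) K₀ γ, ?_, ?_,
    ⟨H₀ + gcomp (show (-1:ℤ) + 0 = -1 by omega) H₀ η
      - gcomp (show (-2:ℤ) + 1 = -1 by omega) y₀ γ, ?_, ?_⟩,
    ⟨K₀ + gcomp (show (-1:ℤ) + 0 = -1 by omega) K₀ κ
      + gcomp (show (0:ℤ) + -1 = -1 by omega) g₀ ι, ?_, ?_⟩⟩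
  · simp only [Fmap_add, Fmap_gcomp, Fη, Fγ, gcomp_zero, add_zero]
  · simp only [gdelta_add,
      gdelta_gcomp dDb dCb dCb (show (0:ℤ) + 1 = 1 by omega) (show (0:ℤ) + 1 = 1 by omega),
      gdelta_gcomp dDb dDb dCb (show (-1:ℤ) + 1 = 0 by omega) (show (1:ℤ) + 1 = 2 by omega),
      hγ, dη, dγ, hκ, hγη, hκγ, gcomp_neg, sub_gcomp, gcomp_zero, smul_zero, gid_gcomp,
      gcomp_assoc (show (0:ℤ) + 1 = 1 by omega), Int.negOnePow_one, Units.val_neg, Units.val_one,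
      one_smul, neg_smul]
    abel
  · simp only [Fmap_add, Fmap_sub, Fmap_gcomp, Fη, Fγ, gcomp_zero, add_zero, sub_zero]
  · simp only [gdelta_add, gdelta_sub,
      gdelta_gcomp dCb dCb dCb (show (-1:ℤ) + 1 = 0 by omega) (show (0:ℤ) + 1 = 1 by omega),
      gdelta_gcomp dCb dDb dCb (show (-2:ℤ) + 1 = -1 by omega) (show (1:ℤ) + 1 = 2 by omega),
      hη, hι, dη, dγ, hηη, hιγ, gcomp_neg, sub_gcomp, gcomp_add, gcomp_zero, gid_gcomp,
      gcomp_assoc (show (0:ℤ) + 0 = 0 by omega), gcomp_assoc (show (0:ℤ) + 1 = 1 by omega),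
      gcomp_assoc (show (-1:ℤ) + 1 = 0 by omega), Int.negOnePow_zero,
      Int.negOnePow_one, Units.val_neg, Units.val_one, one_smul, neg_smul]
    abel
  · simp only [Fmap_add, Fmap_gcomp, Fκ, Fι, gcomp_zero, add_zero]
  · simp only [gdelta_add,
      gdelta_gcomp dDb dDb dDb (show (-1:ℤ) + 1 = 0 by omega) (show (0:ℤ) + 1 = 1 by omega),
      gdelta_gcomp dDb dCb dDb (show (0:ℤ) + 1 = 1 by omega) (show (-1:ℤ) + 1 = 0 by omega),
      hγ, hκ, dκ, dι, hκκ, hγι, gcomp_neg, gcomp_sub, sub_gcomp, add_gcomp, smul_zero, gid_gcomp,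
      gcomp_assoc (show (0:ℤ) + 0 = 0 by omega), gcomp_assoc (show (1:ℤ) + 0 = 1 by omega),
      Int.negOnePow_zero, Units.val_one, one_smul]
    abel

end Paper
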